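/- Let T : ℕ → ℝ be positive with T(ℓ+m) ≥ T(ℓ)*T(m) whenever ℓ, m ≥ 1 are not both 1, and T(n) ≤ 4^n for all n. If T(75) ≥ 15936363137225733301433441827683823, then lim_{n→∞} T(n)^(1/n) > 2.8578. -/

import Mathlib

open Filter

theorem stmt_16 (T : ℕ → ℝ) (hpos : ∀ n, 0 < T n)
    (hsuper : ∀ ℓ m, 1 ≤ ℓ → 1 ≤ m → ¬(ℓ = 1 ∧ m = 1) → T (ℓ + m) ≥ T ℓ * T m)
    (hub : ∀ n, T n ≤ 4 ^ n)
    (h75 : T 75 ≥ 15936363137225733301433441827683823) :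
    ∃ L : ℝ, Tendsto (fun n : ℕ => T n ^ ((1 : ℝ) / n)) atTop (nhds L) ∧ L > 2.8578 := by
  -- modify `-log T` at 0 and 1 so that it becomes genuinely subadditive
  obtain ⟨u, hu⟩ : ∃ u : ℕ → ℝ, u = fun n => if n = 0 then 0 else
      if n = 1 then max (-Real.log (T 1)) (-Real.log (T 2) / 2) else -Real.log (T n) := ⟨_, rfl⟩
  have u0 : u 0 = 0 := by simp [hu]
  have u1 : u 1 = max (-Real.log (T 1)) (-Real.log (T 2) / 2) := by simp [hu]
  have u2 : ∀ n, 2 ≤ n → u n = -Real.log (T n) := by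
    intro n hn
    have h0 : n ≠ 0 := by omega
    have h1 : n ≠ 1 := by omega
    simp [hu, h0, h1]
  have uge : ∀ n, 1 ≤ n → -Real.log (T n) ≤ u n := by
    intro n hn
    rcases Nat.lt_or_ge n 2 with h | h
    · obtain rfl : n = 1 := by omega
      rw [u1]; exact le_max_left _ _
    · exact (u2 n h).ge
  have hsub : Subadditive u := by
    intro m n
    rcases Nat.eq_zero_or_pos m with rfl | hm
    · simp [u0]
    rcases Nat.eq_zero_or_pos n with rfl | hn
    · simp [u0]
    by_cases h : m = 1 ∧ n = 1
    · obtain ⟨rfl, rfl⟩ := h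
      have := le_max_right (-Real.log (T 1)) (-Real.log (T 2) / 2)
      rw [← u1] at this
      rw [u2 (1 + 1) (by norm_num)]
      norm_num
      linarith
    · rw [u2 (m + n) (by omega)]
      have h1 := Real.log_le_log (mul_pos (hpos m) (hpos n)) (hsuper m n hm hn h)
      rw [Real.log_mul (hpos m).ne' (hpos n).ne'] at h1
      have := uge m hm
      have := uge n hn
      linarith
  have hl4 : 0 < Real.log 4 := Real.log_pos (by norm_num)
  have hbdd : BddBelow (Set.range fun n : ℕ => u n / n) := by
    refine ⟨-Real.log 4, ?_⟩
    rintro _ ⟨n, rfl⟩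
    rcases Nat.eq_zero_or_pos n with rfl | hn
    · simp [hl4.le]
    · have hn' : (0 : ℝ) < n := by exact_mod_cast hn
      have h1 := Real.log_le_log (hpos n) (hub n)
      rw [Real.log_pow] at h1
      have := uge n hn
      simp only
      rw [le_div_iff₀ hn']
      nlinarith
  refine ⟨Real.exp (-hsub.lim), ?_, ?_⟩
  · have h := (Real.continuous_exp.tendsto _).comp (hsub.tendsto_lim hbdd).neg
    refine h.congr' ?_
    filter_upwards [eventually_ge_atTop 2] with n hn
    simp only [Function.comp]
    rw [Real.rpow_def_of_pos (hpos n), u2 n hn]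
    congr 1
    ring
  · have h := hsub.lim_le_div hbdd (n := 75) (by norm_num)
    rw [u2 75 (by norm_num)] at h
    have h1 : Real.log ((2.8578 : ℝ) ^ 75) < Real.log (T 75) :=
      Real.log_lt_log (by positivity) (lt_of_lt_of_le (by norm_num) h75)
    rw [Real.log_pow] at h1
    rw [gt_iff_lt, ← Real.log_lt_iff_lt_exp (by norm_num)]
    push_cast at h h1
    linarith
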